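/- arXiv:1611.04238 — 4 statements merged into one kernel-verified Lean document; each statement's English description precedes it below -/
import Mathlib

section
/- Let A be an ℕ-graded associative unital ℂ-algebra with grading 𝒜 (a GradedAlgebra) which is graded-commutative, i.e. for all p, q and all homogeneous x ∈ 𝒜 p, y ∈ 𝒜 q one has x·y = (−1)^(p·q) • (y·x). Let c : A → A be a ring homomorphism that is conjugate-linear over ℂ (c(λ • x) = conj(λ) • c(x) for λ ∈ ℂ) and degree-preserving (c maps 𝒜 k into 𝒜 k for every k). Define the star operation on a homogeneous element x of degree k by x* := (−1)^(k(k+1)/2) • c(x). Then for all homogeneous x ∈ 𝒜 p and y ∈ 𝒜 q, one has (x·y)* = y* · x*. -/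
/-- The triangular number of a sum. -/
theorem add_mul_add_add_one_div_two (p q : ℕ) :
    (p + q) * (p + q + 1) / 2 = p * (p + 1) / 2 + q * (q + 1) / 2 + p * q := by
  have hp := Nat.div_mul_cancel (Nat.even_mul_succ_self p).two_dvd
  have hq := Nat.div_mul_cancel (Nat.even_mul_succ_self q).two_dvd
  apply Nat.div_eq_of_eq_mul_left two_pos
  linear_combination -hp - hq

/-- Lemma 2.7 of the paper, in abstract form: in an ℕ-graded graded-commutative ℂ-algebra
with a degree-preserving conjugate-linear ring homomorphism `c`, the star operation
`x* = (−1)^(k(k+1)/2) • c x` on homogeneous elements of degree `k` satisfies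
`(x·y)* = y* · x*`. -/
theorem star_antimultiplicative_of_gradedComm
    (A : Type*) [Ring A] [Algebra ℂ A] (𝒜 : ℕ → Submodule ℂ A) [GradedAlgebra 𝒜]
    (hcomm : ∀ (p q : ℕ), ∀ x ∈ 𝒜 p, ∀ y ∈ 𝒜 q, x * y = ((-1 : ℂ) ^ (p * q)) • (y * x))
    (c : A →+* A)
    (hconj : ∀ (l : ℂ) (x : A), c (l • x) = (starRingEnd ℂ l) • c x)
    (hdeg : ∀ (k : ℕ), ∀ x ∈ 𝒜 k, c x ∈ 𝒜 k)
    (p q : ℕ) (x : A) (hx : x ∈ 𝒜 p) (y : A) (hy : y ∈ 𝒜 q) :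
    ((-1 : ℂ) ^ ((p + q) * (p + q + 1) / 2)) • c (x * y) =
      (((-1 : ℂ) ^ (q * (q + 1) / 2)) • c y) * (((-1 : ℂ) ^ (p * (p + 1) / 2)) • c x) := by
  rw [map_mul, hcomm p q _ (hdeg p x hx) _ (hdeg q y hy), smul_smul, smul_mul_smul_comm,
    add_mul_add_add_one_div_two, ← pow_add, ← pow_add,
    show p * (p + 1) / 2 + q * (q + 1) / 2 + p * q + p * q =
      q * (q + 1) / 2 + p * (p + 1) / 2 + 2 * (p * q) by ring,
    pow_add _ _ (2 * (p * q)), (even_two_mul (p * q)).neg_one_pow, mul_one]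
end

section
/- Let A be a complex Banach algebra with unit, E a real normed vector space, U ⊆ E an open set, and h : U → A a C² map (ContDiffOn ℝ 2) such that h x is invertible for every x ∈ U. Define θ : U → E → A by θ x v = (h x)⁻¹ * (fderiv ℝ h x v). Then for every x ∈ U and all u, v ∈ E: fderiv ℝ (fun y => θ y v) x u − fderiv ℝ (fun y => θ y u) x v = −((θ x u)·(θ x v) − (θ x v)·(θ x u)). In other words, the A-valued one-form θ = h⁻¹·dh satisfies the Maurer–Cartan equation dθ = −θ². -/
theorem fderiv_ringInverse_mul_fderiv_apply {A E : Type*} [NormedRing A] [NormedAlgebra ℝ A]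
    [CompleteSpace A] [NormedAddCommGroup E] [NormedSpace ℝ E] {h : E → A} {x : E}
    (hh : ContDiffAt ℝ 2 h x) (hx : IsUnit (h x)) (u v : E) :
    fderiv ℝ (fun y => Ring.inverse (h y) * fderiv ℝ h y v) x u =
      Ring.inverse (h x) * fderiv ℝ (fderiv ℝ h) x u v -
        (Ring.inverse (h x) * fderiv ℝ h x u) * (Ring.inverse (h x) * fderiv ℝ h x v) := by
  obtain ⟨a, ha⟩ := hx
  have hd : HasFDerivAt h (fderiv ℝ h x) x :=
    (hh.differentiableAt (by norm_num)).hasFDerivAt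
  have hdd : HasFDerivAt (fderiv ℝ h) (fderiv ℝ (fderiv ℝ h) x) x :=
    ((hh.fderiv_right (m := 1) (by norm_num)).differentiableAt (by norm_num)).hasFDerivAt
  have hinv : HasFDerivAt Ring.inverse
      (-ContinuousLinearMap.mulLeftRight ℝ A ↑a⁻¹ ↑a⁻¹) (h x) :=
    ha ▸ hasFDerivAt_ringInverse (𝕜 := ℝ) a
  have hprod := (hinv.comp x hd).mul' (hdd.clm_apply (hasFDerivAt_const v x))
  refine (congrArg (fun L : E →L[ℝ] A => L u) hprod.fderiv).trans ?_
  simp [← ha, mul_assoc, sub_eq_add_neg]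

/-- Lemma 3.5 of the paper: the Maurer–Cartan one-form `θ = h⁻¹·dh` associated to a C²
family of invertible elements of a Banach algebra satisfies the Maurer–Cartan equation
`dθ = −θ²`, i.e. the antisymmetrized derivative of `θ` equals minus the commutator of
its values. -/
theorem maurerCartan_equation
    (A : Type*) [NormedRing A] [NormedAlgebra ℂ A] [CompleteSpace A]
    (E : Type*) [NormedAddCommGroup E] [NormedSpace ℝ E]
    (U : Set E) (hU : IsOpen U)
    (h : E → A) (hh : ContDiffOn ℝ 2 h U)
    (hinv : ∀ x ∈ U, IsUnit (h x))
    (θ : E → E → A)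
    (hθ : ∀ x (v : E), θ x v = Ring.inverse (h x) * (fderiv ℝ h x v))
    (x : E) (hx : x ∈ U) (u v : E) :
    fderiv ℝ (fun y => θ y v) x u - fderiv ℝ (fun y => θ y u) x v =
      -((θ x u) * (θ x v) - (θ x v) * (θ x u)) := by
  have key (v u : E) := fderiv_ringInverse_mul_fderiv_apply
    (hh.contDiffAt (hU.mem_nhds hx)) (hinv x hx) v u
  have hsymm : fderiv ℝ (fderiv ℝ h) x u v = fderiv ℝ (fderiv ℝ h) x v u :=
    (hh.contDiffAt (hU.mem_nhds hx)).isSymmSndFDerivAt (by simp) u v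
  simp only [hθ]
  rw [key u v, key v u, hsymm]
  abel
end

section
/- Let A be a complex Banach algebra with unit, c : ℕ → ℂ, and x, b ∈ A, and suppose there exists s with ‖x‖ < s such that ∑ₙ ‖c n‖ · sⁿ is summable. Define F : ℝ → A by F t := ∑'ₙ c n • (x + t • b)^n (which converges for |t| small enough that ‖x + t•b‖ < s). Then F has derivative at t = 0 equal to ∑'ₙ c n • (∑_{i ∈ Finset.range n} x^i * b * x^(n−1−i)), i.e. HasDerivAt F (∑'ₙ c n • ∑_{i<n} x^i b x^{n−1−i}) 0. -/
/-- A power bound that does not require `‖1‖ = 1`. -/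
lemma norm_pow_le_max_one_mul_pow {A : Type*} [NormedRing A] {y : A} {r : ℝ}
    (hy : ‖y‖ ≤ r) (n : ℕ) : ‖y ^ n‖ ≤ max 1 ‖(1 : A)‖ * r ^ n := by
  have hr : 0 ≤ r := (norm_nonneg y).trans hy
  rcases Nat.eq_zero_or_pos n with rfl | hn
  · simp
  · calc ‖y ^ n‖ ≤ ‖y‖ ^ n := norm_pow_le' y hn
      _ ≤ 1 * r ^ n := by rw [one_mul]; gcongr
      _ ≤ max 1 ‖(1 : A)‖ * r ^ n := by gcongr; exact le_max_left _ _

lemma nat_mul_pow_pred_le_pow_div_sub {r s : ℝ} (hr : 0 ≤ r) (hrs : r < s) (n : ℕ) :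
    n * r ^ (n - 1) ≤ s ^ n / (s - r) := by
  have hsr : 0 < s - r := sub_pos.2 hrs
  rw [le_div_iff₀ hsr]
  have hterm : (n : ℝ) * r ^ (n - 1) ≤ ∑ i ∈ Finset.range n, s ^ i * r ^ (n - 1 - i) := by
    have h : ∀ i ∈ Finset.range n, r ^ (n - 1) ≤ s ^ i * r ^ (n - 1 - i) := by
      intro i hi
      have hi' : i + (n - 1 - i) = n - 1 := by have := Finset.mem_range.1 hi; omega
      calc r ^ (n - 1) = r ^ i * r ^ (n - 1 - i) := by rw [← pow_add, hi']
        _ ≤ s ^ i * r ^ (n - 1 - i) := by gcongr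
    simpa using Finset.card_nsmul_le_sum _ _ _ h
  calc (n : ℝ) * r ^ (n - 1) * (s - r)
      ≤ (∑ i ∈ Finset.range n, s ^ i * r ^ (n - 1 - i)) * (s - r) := by gcongr
    _ = s ^ n - r ^ n := (Commute.all s r).geom_sum₂_mul n
    _ ≤ s ^ n := sub_le_self _ (pow_nonneg hr n)

lemma norm_sum_pow_mul_mul_pow_le {A : Type*} [NormedRing A] {y : A} {r : ℝ}
    (b : A) (hy : ‖y‖ ≤ r) (n : ℕ) :
    ‖∑ i ∈ Finset.range n, y ^ i * b * y ^ (n - 1 - i)‖ ≤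
      max 1 ‖(1 : A)‖ ^ 2 * ‖b‖ * (n * r ^ (n - 1)) := by
  have hr : 0 ≤ r := (norm_nonneg y).trans hy
  set K := max 1 ‖(1 : A)‖
  have h : ∀ i ∈ Finset.range n,
      ‖y ^ i * b * y ^ (n - 1 - i)‖ ≤ K ^ 2 * ‖b‖ * r ^ (n - 1) := by
    intro i hi
    have hi' : i + (n - 1 - i) = n - 1 := by have := Finset.mem_range.1 hi; omega
    calc ‖y ^ i * b * y ^ (n - 1 - i)‖
        ≤ ‖y ^ i‖ * ‖b‖ * ‖y ^ (n - 1 - i)‖ := norm_mul₃_le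
      _ ≤ (K * r ^ i) * ‖b‖ * (K * r ^ (n - 1 - i)) := by
          gcongr <;> exact norm_pow_le_max_one_mul_pow hy _
      _ = K ^ 2 * ‖b‖ * r ^ (n - 1) := by rw [← hi', pow_add, hi']; ring
  refine (norm_sum_le_of_le _ h).trans_eq ?_
  rw [Finset.sum_const, Finset.card_range, nsmul_eq_mul]
  ring

lemma hasDerivAt_add_smul_pow {A : Type*} [NormedRing A] [NormedAlgebra ℝ A]
    (x b : A) (n : ℕ) (t : ℝ) :
    HasDerivAt (fun t : ℝ => (x + t • b) ^ n)
      (∑ i ∈ Finset.range n, (x + t • b) ^ i * b * (x + t • b) ^ (n - 1 - i)) t := by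
  have h : HasDerivAt (fun t : ℝ => x + t • b) b t := by
    simpa using ((hasDerivAt_id t).smul_const b).const_add x
  convert h.fun_pow' n using 1
  rw [← Finset.sum_range_reflect]
  refine Finset.sum_congr rfl fun i hi => ?_
  have hi' : n - 1 - (n - 1 - i) = i := by have := Finset.mem_range.1 hi; omega
  rw [hi', Nat.pred_eq_sub_one]

/-- The differentiation rule for power-series functional calculus used throughout
Section 3 of the paper: for `F t = ∑ₙ cₙ • (x + t•b)^n` with `‖x‖ < s` within the radius
of convergence, `F` has derivative at `t = 0` equal to the noncommutative directional
derivative `f'(x; b) = ∑ₙ cₙ • ∑_{i<n} x^i · b · x^(n−1−i)`. -/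
theorem hasDerivAt_power_series_functional_calculus
    (A : Type*) [NormedRing A] [NormedAlgebra ℂ A] [CompleteSpace A]
    (c : ℕ → ℂ) (x b : A) (s : ℝ) (hs : ‖x‖ < s)
    (hsum : Summable fun n : ℕ => ‖c n‖ * s ^ n)
    (F : ℝ → A) (hF : ∀ t : ℝ, F t = ∑' n : ℕ, c n • (x + t • b) ^ n) :
    HasDerivAt F
      (∑' n : ℕ, c n • (∑ i ∈ Finset.range n, x ^ i * b * x ^ (n - 1 - i))) 0 := by
  obtain ⟨r, hxr, hrs⟩ := exists_between hs
  have hr : 0 ≤ r := (norm_nonneg x).trans hxr.le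
  have hcont : Continuous fun t : ℝ => ‖x + t • b‖ := by fun_prop
  have hev : ∀ᶠ t : ℝ in nhds 0, ‖x + t • b‖ < r :=
    hcont.continuousAt.eventually_lt continuousAt_const (by simpa using hxr)
  obtain ⟨δ, hδ, hball⟩ := Metric.eventually_nhds_iff_ball.1 hev
  set K := max 1 ‖(1 : A)‖
  have hu : Summable fun n : ℕ => K ^ 2 * ‖b‖ / (s - r) * (‖c n‖ * s ^ n) :=
    hsum.mul_left _
  have hsum₀ : Summable fun n : ℕ => c n • (x + (0 : ℝ) • b) ^ n := by
    refine .of_norm_bounded (hsum.mul_left K) fun n => ?_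
    rw [zero_smul, add_zero, norm_smul, mul_left_comm]
    gcongr
    exact norm_pow_le_max_one_mul_pow hs.le n
  have hderiv := hasDerivAt_tsum_of_isPreconnected (y := (0 : ℝ)) hu Metric.isOpen_ball
    (convex_ball (0 : ℝ) δ).isPreconnected
    (fun n t _ => (hasDerivAt_add_smul_pow x b n t).const_smul (c n))
    (fun n t ht => ?_) (Metric.mem_ball_self hδ) hsum₀ (Metric.mem_ball_self hδ)
  · rw [funext hF]
    simpa only [Pi.smul_apply, zero_smul, add_zero] using hderiv
  · rw [norm_smul]
    calc ‖c n‖ * _ ≤ ‖c n‖ * (K ^ 2 * ‖b‖ * (n * r ^ (n - 1))) := by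
          gcongr
          exact norm_sum_pow_mul_mul_pow_le b (hball t ht).le n
      _ ≤ ‖c n‖ * (K ^ 2 * ‖b‖ * (s ^ n / (s - r))) := by
          gcongr
          exact nat_mul_pow_pred_le_pow_div_sub hr hrs n
      _ = K ^ 2 * ‖b‖ / (s - r) * (‖c n‖ * s ^ n) := by ring
end

section
/- Let V be a complex Banach space, K ∈ ℕ, and let N and E_0, …, E_K be continuous linear endomorphisms of V such that N ∘ E_k − E_k ∘ N = (1 − k) • E_k for each k = 0, …, K (where (1−k) is an integer scalar). For t > 0 define 𝔈 t := ∑_{k=0}^{K} (t : ℝ)^(1−k : ℤ) • E_k (real zpow). Then for every t > 0, the map t ↦ 𝔈 t has derivative t⁻¹ • (N ∘ 𝔈 t − 𝔈 t ∘ N) at t, i.e. HasDerivAt 𝔈 (t⁻¹ • (N ∘ 𝔈 t − 𝔈 t ∘ N)) t. -/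
/-- Lemma 4.4 of the paper ('degree commutator'): if `N` and `E_0, …, E_K` are continuous
linear endomorphisms of a complex Banach space with `[N, E_k] = (1−k) • E_k`, then the
rescaled family `𝔈 t = ∑_k t^(1−k) • E_k` (for `t > 0`) satisfies
`d/dt 𝔈 t = t⁻¹ • [N, 𝔈 t]`. -/
theorem hasDerivAt_rescaled_superconnection
    (V : Type*) [NormedAddCommGroup V] [NormedSpace ℂ V] [CompleteSpace V]
    (K : ℕ) (N : V →L[ℂ] V) (E : ℕ → (V →L[ℂ] V))
    (hcomm : ∀ k ≤ K, N.comp (E k) - (E k).comp N = ((1 : ℤ) - (k : ℤ)) • E k)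
    (𝔈 : ℝ → (V →L[ℂ] V))
    (h𝔈 : ∀ t : ℝ, 𝔈 t = ∑ k ∈ Finset.range (K + 1), (t ^ ((1 : ℤ) - (k : ℤ))) • E k)
    (t : ℝ) (ht : 0 < t) :
    HasDerivAt 𝔈 (t⁻¹ • (N.comp (𝔈 t) - (𝔈 t).comp N)) t := by
  have hderiv : HasDerivAt 𝔈 (∑ k ∈ Finset.range (K + 1),
      ((((1 : ℤ) - (k : ℤ) : ℤ) : ℝ) * t ^ ((1 : ℤ) - (k : ℤ) - 1)) • E k) t := by
    rw [funext h𝔈]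
    exact HasDerivAt.fun_sum fun k _ =>
      (hasDerivAt_zpow ((1 : ℤ) - (k : ℤ)) t (Or.inl ht.ne')).smul_const (E k)
  convert hderiv using 1
  rw [h𝔈, ContinuousLinearMap.comp_finsetSum, ContinuousLinearMap.finsetSum_comp,
    ← Finset.sum_sub_distrib, Finset.smul_sum]
  refine Finset.sum_congr rfl fun k hk => ?_
  rw [ContinuousLinearMap.comp_smul, ContinuousLinearMap.smul_comp, ← smul_sub,
    hcomm k (Nat.lt_succ_iff.mp (Finset.mem_range.mp hk)), ← Int.cast_smul_eq_zsmul ℝ,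
    smul_smul, smul_smul, zpow_sub_one₀ ht.ne']
  congr 1
  ring
end
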